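/- For every finite simple graph G, the homological connectivity of the independence complex is at least the vector domination number: η(I(G)) ≥ Γ(G). -/

import Mathlib

open Finset
open scoped ENNReal
/-- An ordered tuple of vertices spans a simplex of the flag complex `X(G)`
iff its entries are pairwise adjacent. -/
def SimpleGraph.IsFlagSimplex {V : Type*} (G : SimpleGraph V) {m : ℕ} (σ : Fin m → V) : Prop :=
  ∀ i j : Fin m, i ≠ j → G.Adj (σ i) (σ j)

/-- A (real) simplicial cochain of `X(G)` in degree `m - 1`: a skew-symmetric function
on ordered `m`-tuples of vertices, supported on the ordered simplices of `X(G)`.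
(For `m = 0` this is the augmented degree `-1` part, a copy of `ℝ`.) -/
def SimpleGraph.IsFlagCochain {V : Type*} (G : SimpleGraph V) {m : ℕ}
    (φ : (Fin m → V) → ℝ) : Prop :=
  (∀ σ : Fin m → V, ¬ G.IsFlagSimplex σ → φ σ = 0) ∧
  (∀ (σ : Fin m → V) (π : Equiv.Perm (Fin m)),
    φ (σ ∘ π) = ((Equiv.Perm.sign π : ℤ) : ℝ) * φ σ)

open scoped Classical in
/-- The simplicial coboundary operator `d` of the flag complex `X(G)`:
`(dφ)(σ) = ∑ i, (-1)^i φ(σ with i-th entry removed)` for an ordered simplex `σ`. -/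
noncomputable def SimpleGraph.coboundary {V : Type*} (G : SimpleGraph V) {m : ℕ}
    (φ : (Fin m → V) → ℝ) : (Fin (m + 1) → V) → ℝ :=
  fun σ =>
    if G.IsFlagSimplex σ then
      ∑ i : Fin (m + 1), (-1 : ℝ) ^ (i : ℕ) * φ (σ ∘ i.succAbove)
    else 0
/-- Vanishing of the reduced cohomology `H̃^k(X(G); ℝ)`: every `k`-cocycle is a coboundary
(for `k = 0`, degree `-1` cochains are the constants, giving *reduced* cohomology). -/
def SimpleGraph.flagCohomologyVanishes {V : Type*} (G : SimpleGraph V) (k : ℕ) : Prop :=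
  ∀ φ : (Fin (k + 1) → V) → ℝ, G.IsFlagCochain φ → G.coboundary φ = 0 →
    ∃ ψ : (Fin k → V) → ℝ, G.IsFlagCochain ψ ∧ G.coboundary ψ = φ
/-- The homological connectivity `η(I(G)) = min{ i : H̃^i(I(G);ℝ) ≠ 0 } + 1 ∈ ℕ∞`
of the independence complex `I(G) = X(Gᶜ)` (`= ⊤` if all reduced cohomology vanishes). -/
noncomputable def SimpleGraph.indepEta {V : Type*} (G : SimpleGraph V) : ℕ∞ :=
  sInf {i : ℕ∞ | ∃ k : ℕ, (k : ℕ∞) = i ∧ ¬ (Gᶜ).flagCohomologyVanishes k} + 1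
/-- A vector representation of `G`: an assignment of vectors to the vertices with
`P(u)·P(v) ≥ 1` for adjacent `u, v` and `P(u)·P(v) ≥ 0` for non-adjacent `u, v`. -/
def SimpleGraph.IsVectorRep {V : Type*} (G : SimpleGraph V) {ι : Type*} [Fintype ι]
    (P : V → ι → ℝ) : Prop :=
  (∀ u v : V, G.Adj u v → 1 ≤ ∑ i, P u i * P v i) ∧
  (∀ u v : V, ¬ G.Adj u v → 0 ≤ ∑ i, P u i * P v i)
/-- The value `|P|` of a vector representation: the infimum of `∑_v α(v)` over nonnegative
`α` with `∑_v α(v) P(v)·P(u) ≥ 1` for every vertex `u` (`= ⊤` if no such `α` exists). -/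
noncomputable def repValue {V : Type*} [Fintype V] {ι : Type*} [Fintype ι]
    (P : V → ι → ℝ) : ℝ≥0∞ :=
  sInf {x : ℝ≥0∞ | ∃ α : V → ℝ, (∀ v, 0 ≤ α v) ∧
    (∀ u : V, 1 ≤ ∑ v, α v * ∑ i, P v i * P u i) ∧ x = ENNReal.ofReal (∑ v, α v)}

/-- `Γ(G)`: the supremum of `|P|` over all vector representations `P` of `G`. -/
noncomputable def SimpleGraph.vecGamma {V : Type*} [Fintype V] (G : SimpleGraph V) : ℝ≥0∞ :=
  sSup {x : ℝ≥0∞ | ∃ (ℓ : ℕ) (P : V → Fin ℓ → ℝ), G.IsVectorRep P ∧ x = repValue P}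

/-- A permutation of `Fin (n + 1)` carries the `i`-th face to the `π i`-th face through a
permutation of `Fin n` whose sign is that of `π` up to `(-1) ^ (i + π i)`. -/
theorem Equiv.Perm.exists_comp_succAbove {n : ℕ} (π : Equiv.Perm (Fin (n + 1))) (i : Fin (n + 1)) :
    ∃ ρ : Equiv.Perm (Fin n), π ∘ i.succAbove = (π i).succAbove ∘ ρ ∧
      Equiv.Perm.sign π = (-1) ^ (i : ℕ) * (-1) ^ (π i : ℕ) * Equiv.Perm.sign ρ := by
  set θ : Equiv.Perm (Fin (n + 1)) := (π i).cycleRange * π * i.cycleRange⁻¹ with hθ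
  obtain ⟨⟨p, ρ⟩, hp⟩ := Equiv.Perm.decomposeFin.symm.surjective θ
  have h0 : θ 0 = 0 := by
    simp [hθ, Equiv.Perm.inv_def]
  have hp0 : p = 0 := by
    rw [← h0, ← hp, Equiv.Perm.decomposeFin_symm_apply_zero]
  subst hp0
  refine ⟨ρ, ?_, ?_⟩
  · funext j
    have h1 : θ j.succ = (ρ j).succ := by
      rw [← hp, Equiv.Perm.decomposeFin_symm_apply_succ]; simp
    have h2 : (π i).cycleRange (π (i.succAbove j)) = (ρ j).succ := by
      rw [← h1]; simp [hθ, Equiv.Perm.inv_def]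
    have h3 := congrArg (π i).cycleRange.symm h2
    simpa using h3
  · have h1 : Equiv.Perm.sign ρ = Equiv.Perm.sign θ := by
      rw [← hp, Equiv.Perm.decomposeFin.symm_sign]; simp
    rw [h1, hθ]
    simp only [map_mul, Fin.sign_cycleRange, map_inv, Int.units_inv_eq_self]
    have hs (m : ℕ) : ((-1 : ℤˣ) ^ m) * (-1) ^ m = 1 := by rw [← mul_pow]; simp
    calc _ = ((-1) ^ (i : ℕ) * (-1) ^ (i : ℕ)) * ((-1) ^ (π i : ℕ) * (-1) ^ (π i : ℕ)) *
          Equiv.Perm.sign π := by simp only [hs, one_mul]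
      _ = _ := by simp only [mul_assoc, mul_comm, mul_left_comm]

theorem neg_one_pow_mul_self_eq_one (n : ℕ) : (-1 : ℝ) ^ n * (-1) ^ n = 1 := by
  rw [← mul_pow]; simp

namespace SimpleGraph

variable {V : Type*} {H : SimpleGraph V} {m n : ℕ}

theorem IsFlagSimplex.comp {σ : Fin m → V} (h : H.IsFlagSimplex σ) {f : Fin n → Fin m}
    (hf : Function.Injective f) : H.IsFlagSimplex (σ ∘ f) :=
  fun i j hij => h (f i) (f j) (hf.ne hij)

theorem isFlagSimplex_comp_perm {σ : Fin m → V} (π : Equiv.Perm (Fin m)) :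
    H.IsFlagSimplex (σ ∘ π) ↔ H.IsFlagSimplex σ := by
  refine ⟨fun h => ?_, fun h => h.comp π.injective⟩
  have := h.comp π.symm.injective
  rwa [Function.comp_assoc, Equiv.self_comp_symm, Function.comp_id] at this

theorem isFlagSimplex_cons {σ : Fin m → V} {v : V} :
    H.IsFlagSimplex (Fin.cons v σ : Fin (m + 1) → V) ↔
      (∀ i, H.Adj v (σ i)) ∧ H.IsFlagSimplex σ := by
  constructor
  · refine fun h => ⟨fun i => ?_, fun i j hij => ?_⟩
    · simpa using h 0 i.succ (Fin.succ_ne_zero i).symm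
    · simpa using h i.succ j.succ (by simpa using hij)
  · rintro ⟨h1, h2⟩ i j hij
    cases i using Fin.cases <;> cases j using Fin.cases
    · exact absurd rfl hij
    · simpa using h1 _
    · simpa using (h1 _).symm
    · simpa using h2 _ _ (by simpa using hij)

theorem IsFlagCochain.coboundary {φ : (Fin m → V) → ℝ} (hφ : H.IsFlagCochain φ) :
    H.IsFlagCochain (H.coboundary φ) := by
  refine ⟨fun σ hσ => if_neg hσ, fun σ π => ?_⟩
  by_cases hσ : H.IsFlagSimplex σ
  · simp only [SimpleGraph.coboundary, if_pos hσ, if_pos ((isFlagSimplex_comp_perm π).2 hσ)]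
    rw [Finset.mul_sum]
    refine Fintype.sum_equiv π _ _ fun i => ?_
    obtain ⟨ρ, h1, h2⟩ := π.exists_comp_succAbove i
    rw [Function.comp_assoc, h1, ← Function.comp_assoc, hφ.2, h2]
    push_cast
    linear_combination (-1 : ℝ) ^ (i : ℕ) * (Equiv.Perm.sign ρ : ℤ) *
      φ (σ ∘ (π i).succAbove) * -neg_one_pow_mul_self_eq_one (π i : ℕ)
  · simp [SimpleGraph.coboundary, hσ, isFlagSimplex_comp_perm]

theorem coboundary_coboundary (φ : (Fin m → V) → ℝ) :
    H.coboundary (H.coboundary φ) = 0 := by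
  funext σ
  by_cases hσ : H.IsFlagSimplex σ
  · have hf (i : Fin (m + 2)) : H.IsFlagSimplex (σ ∘ i.succAbove) :=
      hσ.comp Fin.succAbove_right_injective
    simp only [SimpleGraph.coboundary, if_pos hσ, hf, if_true, Finset.mul_sum, Pi.zero_apply]
    rw [← Finset.sum_product']
    have hadd (p : Fin (m + 2) × Fin (m + 1)) :
        (-1 : ℝ) ^ (p.1 : ℕ) * ((-1) ^ (p.2 : ℕ) * φ ((σ ∘ p.1.succAbove) ∘ p.2.succAbove)) +
        (-1 : ℝ) ^ (p.1.succAbove p.2 : ℕ) * ((-1) ^ (p.2.predAbove p.1 : ℕ) *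
          φ ((σ ∘ (p.1.succAbove p.2).succAbove) ∘ (p.2.predAbove p.1).succAbove)) = 0 := by
      have h1 : (σ ∘ (p.1.succAbove p.2).succAbove) ∘ (p.2.predAbove p.1).succAbove =
          (σ ∘ p.1.succAbove) ∘ p.2.succAbove := by
        funext j
        simp [Fin.succAbove_succAbove_succAbove_predAbove]
      have h2 := Fin.neg_one_pow_succAbove_add_predAbove (R := ℝ) p.1 p.2
      rw [pow_add, pow_add] at h2
      rw [h1]
      linear_combination φ ((σ ∘ p.1.succAbove) ∘ p.2.succAbove) * h2
    refine Finset.sum_involution (fun p _ => (p.1.succAbove p.2, p.2.predAbove p.1))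
      (fun p _ => hadd p) (fun p _ _ h => ?_) (fun p _ => Finset.mem_univ _) (fun p _ => ?_)
    · exact Fin.succAbove_ne p.1 p.2 (congrArg Prod.fst h)
    · ext1
      · exact Fin.succAbove_succAbove_predAbove p.1 p.2
      · exact Fin.predAbove_predAbove_succAbove p.1 p.2
  · simp [SimpleGraph.coboundary, if_neg hσ]

theorem IsFlagCochain.insertNth {φ : (Fin (m + 1) → V) → ℝ} (hφ : H.IsFlagCochain φ)
    (i : Fin (m + 1)) (u : V) (τ : Fin m → V) :
    φ (i.insertNth u τ) = (-1) ^ (i : ℕ) * φ (Fin.cons u τ) := by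
  rw [← Fin.cons_comp_cycleRange, hφ.2, Fin.sign_cycleRange]
  push_cast
  rfl

theorem IsFlagCochain.cons_face {φ : (Fin (m + 1) → V) → ℝ} (hφ : H.IsFlagCochain φ)
    (i : Fin (m + 1)) (σ : Fin (m + 1) → V) :
    (-1) ^ (i : ℕ) * φ (Fin.cons (σ i) (σ ∘ i.succAbove)) = φ σ := by
  rw [← hφ.insertNth]
  congr 1
  exact Fin.insertNth_self_removeNth i σ

variable [Fintype V]

theorem sum_insertNth (i : Fin (m + 1)) (F : (Fin (m + 1) → V) → ℝ) :
    ∑ σ, F σ = ∑ u, ∑ τ, F (i.insertNth u τ) := by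
  rw [← Finset.sum_product', ← (Fin.insertNthEquiv (fun _ => V) i).sum_comp]
  rfl

/-- Summing a skew-symmetric cochain against an alternating sum over faces. -/
theorem IsFlagCochain.sum_mul_alternating {φ : (Fin (m + 1) → V) → ℝ} (hφ : H.IsFlagCochain φ)
    (w : V → ℝ) (g : V → (Fin m → V) → ℝ) :
    ∑ σ, (∏ j, w (σ j)) * φ σ * ∑ i : Fin (m + 1), (-1) ^ (i : ℕ) * g (σ i) (σ ∘ i.succAbove) =
      (m + 1) * ∑ τ, (∏ j, w (τ j)) * ∑ u, w u * φ (Fin.cons u τ) * g u τ := by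
  simp only [Finset.mul_sum]
  rw [Finset.sum_comm]
  have (i : Fin (m + 1)) : ∑ σ, (∏ j, w (σ j)) * φ σ * ((-1) ^ (i : ℕ) * g (σ i) (σ ∘ i.succAbove)) =
      ∑ τ, ∑ u, (∏ j, w (τ j)) * (w u * φ (Fin.cons u τ) * g u τ) := by
    rw [sum_insertNth i, Finset.sum_comm]
    refine Finset.sum_congr rfl fun τ _ => Finset.sum_congr rfl fun u _ => ?_
    have h1 : (i.insertNth u τ : Fin (m + 1) → V) ∘ i.succAbove = τ := by
      funext j; simp
    rw [hφ.insertNth, h1, Fin.insertNth_apply_same, Fin.prod_univ_succAbove _ i]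
    simp only [Fin.insertNth_apply_same, Fin.insertNth_apply_succAbove]
    linear_combination w u * (∏ j, w (τ j)) * φ (Fin.cons u τ) * g u τ *
      neg_one_pow_mul_self_eq_one (i : ℕ)
  rw [Finset.sum_congr rfl fun i _ => this i]
  simp [← Finset.mul_sum]

open scoped Classical in
/-- On a cocycle, the weight of the link of a simplex can be traded for an alternating sum. -/
theorem IsFlagCochain.mul_link_weight {φ : (Fin (m + 1) → V) → ℝ} (hφ : H.IsFlagCochain φ)
    (hd : H.coboundary φ = 0) (w : V → ℝ) {σ : Fin (m + 1) → V} (hσ : H.IsFlagSimplex σ) :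
    φ σ * ∑ v, (if ∀ i, H.Adj v (σ i) then w v else 0) =
      ∑ i : Fin (m + 1), (-1) ^ (i : ℕ) *
        ∑ v, if H.Adj v (σ i) then w v * φ (Fin.cons v (σ ∘ i.succAbove)) else 0 := by
  simp only [Finset.mul_sum]
  rw [Finset.sum_comm]
  refine Finset.sum_congr rfl fun v _ => ?_
  by_cases hv : ∀ i, H.Adj v (σ i)
  · have h1 := congrFun hd (Fin.cons v σ)
    have h2 (i : Fin (m + 1)) : (Fin.cons v σ : Fin (m + 2) → V) ∘ i.succ.succAbove =
        Fin.cons v (σ ∘ i.succAbove) := by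
      funext j
      cases j using Fin.cases <;> simp
    have h3 : (Fin.cons v σ : Fin (m + 2) → V) ∘ (0 : Fin (m + 2)).succAbove = σ := by
      funext j; simp
    rw [SimpleGraph.coboundary, if_pos (isFlagSimplex_cons.2 ⟨hv, hσ⟩), Fin.sum_univ_succ] at h1
    simp only [h2, h3, Fin.val_zero, pow_zero, one_mul, Fin.val_succ, pow_succ, mul_neg, mul_one,
      neg_mul, Finset.sum_neg_distrib, Pi.zero_apply] at h1
    simp only [hv, implies_true, if_true]
    rw [show φ σ = ∑ i : Fin (m + 1), (-1) ^ (i : ℕ) * φ (Fin.cons v (σ ∘ i.succAbove)) by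
      linarith, Finset.sum_mul]
    exact Finset.sum_congr rfl fun i _ => by ring
  · rw [if_neg hv, mul_zero, eq_comm]
    push Not at hv
    obtain ⟨j, hj⟩ := hv
    refine Finset.sum_eq_zero fun i _ => ?_
    split_ifs with hi
    · have hij : j ≠ i := by rintro rfl; exact hj hi
      obtain ⟨l, rfl⟩ := Fin.exists_succAbove_eq hij
      rw [hφ.1 _ fun h => hj ((isFlagSimplex_cons.1 h).1 l)]
      simp
    · simp

open scoped Classical in
/-- The weighted Laplacian estimate: a positive semidefinite nonnegative matrix dominating the
adjacency matrix of `G` bounds the adjacency form from below. -/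
theorem sum_adj_ge {G : SimpleGraph V} {A : V → V → ℝ} (hsymm : ∀ u v, A u v = A v u)
    (hnonneg : ∀ u v, 0 ≤ A u v) (hadj : ∀ u v, G.Adj u v → 1 ≤ A u v)
    (hpsd : ∀ x : V → ℝ, 0 ≤ ∑ u, ∑ v, x u * x v * A u v) {w : V → ℝ} (hw : ∀ v, 0 ≤ w v)
    (y : V → ℝ) :
    ∑ u, w u * y u ^ 2 * (∑ v, (if G.Adj u v then w v else 0) - ∑ v, A u v * w v) ≤
      ∑ u, ∑ v, if G.Adj u v then (w u * y u) * (w v * y v) else 0 := by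
  have key : ∑ u, ∑ v, (if G.Adj u v then w u * w v * (y u - y v) ^ 2 else 0) ≤
      ∑ u, ∑ v, A u v * (w u * w v * (y u - y v) ^ 2) := by
    refine Finset.sum_le_sum fun u _ => Finset.sum_le_sum fun v _ => ?_
    have h := mul_nonneg (mul_nonneg (hw u) (hw v)) (sq_nonneg (y u - y v))
    split_ifs with huv
    · exact le_mul_of_one_le_left h (hadj u v huv)
    · exact mul_nonneg (hnonneg u v) h
  have expand (B : V → V → ℝ) (hB : ∀ u v, B u v = B v u) :
      ∑ u, ∑ v, B u v * (w u * w v * (y u - y v) ^ 2) =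
        2 * ∑ u, w u * y u ^ 2 * ∑ v, B u v * w v -
          2 * ∑ u, ∑ v, (w u * y u) * (w v * y v) * B u v := by
    have h1 : ∑ u, ∑ v, B u v * w u * w v * y v ^ 2 = ∑ u, ∑ v, B u v * w u * w v * y u ^ 2 := by
      rw [Finset.sum_comm]
      exact Finset.sum_congr rfl fun u _ => Finset.sum_congr rfl fun v _ => by rw [hB]; ring
    have h2 : ∑ u, w u * y u ^ 2 * ∑ v, B u v * w v =
        ∑ u, ∑ v, B u v * w u * w v * y u ^ 2 := by
      simp only [Finset.mul_sum]
      exact Finset.sum_congr rfl fun u _ => Finset.sum_congr rfl fun v _ => by ring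
    rw [h2, two_mul]
    nth_rw 2 [← h1]
    simp only [Finset.mul_sum, ← Finset.sum_add_distrib, ← Finset.sum_sub_distrib]
    exact Finset.sum_congr rfl fun u _ => Finset.sum_congr rfl fun v _ => by ring
  have e1 := expand A hsymm
  have e2 := expand (fun u v => if G.Adj u v then 1 else 0) fun u v => by simp [G.adj_comm]
  simp only [ite_mul, one_mul, zero_mul, mul_ite, mul_one, mul_zero] at e2
  have h3 := hpsd fun u => w u * y u
  simp only [mul_sub, Finset.sum_sub_distrib]
  linarith

open scoped Classical in
/-- A weighted harmonic cochain of the independence complex vanishes when the weights are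
sufficiently small against `A`. -/
theorem IsFlagCochain.eq_zero_of_harmonic {G : SimpleGraph V}
    (hH : ∀ u v, H.Adj u v ↔ u ≠ v ∧ ¬ G.Adj u v) {A : V → V → ℝ}
    (hsymm : ∀ u v, A u v = A v u) (hnonneg : ∀ u v, 0 ≤ A u v)
    (hadj : ∀ u v, G.Adj u v → 1 ≤ A u v)
    (hpsd : ∀ x : V → ℝ, 0 ≤ ∑ u, ∑ v, x u * x v * A u v) {w : V → ℝ} (hw : ∀ v, 0 < w v)
    (hsmall : ∀ u, (m + 1) * ∑ v, A u v * w v < ∑ v, w v)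
    {φ : (Fin (m + 1) → V) → ℝ} (hφ : H.IsFlagCochain φ) (hd : H.coboundary φ = 0)
    (hδ : ∀ τ : Fin m → V, ∑ u, w u * φ (Fin.cons u τ) = 0) : φ = 0 := by
  set W : (Fin (m + 1) → V) → ℝ := fun σ => ∏ j, w (σ j) with hW
  set L : (Fin (m + 1) → V) → ℝ := fun σ => ∑ v, if ∀ i, H.Adj v (σ i) then w v else 0 with hL
  set D : V → ℝ := fun u => w u + ∑ v, (if G.Adj u v then w v else 0) with hD
  have hWpos {n : ℕ} (σ : Fin n → V) : 0 < ∏ j, w (σ j) := Finset.prod_pos fun j _ => hw _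
  have link : ∑ σ, W σ * φ σ ^ 2 * L σ = (m + 1) * ∑ τ : Fin m → V, (∏ j, w (τ j)) *
      ∑ u, w u * φ (Fin.cons u τ) *
        ∑ v, if H.Adj v u then w v * φ (Fin.cons v τ) else 0 := by
    rw [← hφ.sum_mul_alternating w
      fun u τ => ∑ v, if H.Adj v u then w v * φ (Fin.cons v τ) else 0]
    refine Finset.sum_congr rfl fun σ _ => ?_
    by_cases hσ : H.IsFlagSimplex σ
    · rw [← hφ.mul_link_weight hd w hσ]; ring
    · simp [hφ.1 σ hσ]
  have vertex_sum (g : V → ℝ) : ∑ σ, W σ * φ σ ^ 2 * ∑ i, g (σ i) = (m + 1) *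
      ∑ τ : Fin m → V, (∏ j, w (τ j)) * ∑ u, w u * φ (Fin.cons u τ) ^ 2 * g u := by
    have h := hφ.sum_mul_alternating w fun u τ => φ (Fin.cons u τ) * g u
    simp only [← mul_assoc, hφ.cons_face] at h
    simp only [← Finset.mul_sum, mul_assoc, sq] at h ⊢
    exact h
  have bound (τ : Fin m → V) :
      ∑ u, w u * φ (Fin.cons u τ) * ∑ v, (if H.Adj v u then w v * φ (Fin.cons v τ) else 0) ≤
      ∑ u, w u * φ (Fin.cons u τ) ^ 2 * (∑ v, A u v * w v - D u) := by
    have h1 := sum_adj_ge hsymm hnonneg hadj hpsd (fun v => (hw v).le) fun u => φ (Fin.cons u τ)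
    have h2 (u v : V) : (if H.Adj v u then w v * φ (Fin.cons v τ) else 0) =
        w v * φ (Fin.cons v τ) - (if u = v then w v * φ (Fin.cons v τ) else 0) -
          (if G.Adj u v then w v * φ (Fin.cons v τ) else 0) := by
      simp only [hH, G.adj_comm v u]
      by_cases huv : u = v
      · subst huv; simp
      · by_cases hG : G.Adj u v <;> simp [huv, hG, Ne.symm huv]
    simp only [h2, Finset.sum_sub_distrib, hδ, Finset.sum_ite_eq, Finset.mem_univ, if_true,
      mul_sub, hD, mul_add, Finset.sum_add_distrib, zero_sub, mul_neg,
      Finset.sum_neg_distrib] at h1 ⊢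
    simp only [Finset.mul_sum, mul_ite, mul_zero] at h1 ⊢
    have h3 : ∑ u, w u * φ (Fin.cons u τ) * (w u * φ (Fin.cons u τ)) =
        ∑ u, w u * φ (Fin.cons u τ) ^ 2 * w u := Finset.sum_congr rfl fun u _ => by ring
    linarith
  have total : ∑ σ, W σ * φ σ ^ 2 * (L σ + ∑ i, (D (σ i) - ∑ v, A (σ i) v * w v)) ≤ 0 := by
    simp only [mul_add (W _ * _), Finset.sum_add_distrib]
    rw [link, vertex_sum fun u => D u - ∑ v, A u v * w v, ← mul_add, ← Finset.sum_add_distrib]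
    refine mul_nonpos_of_nonneg_of_nonpos (by positivity) (Finset.sum_nonpos fun τ _ => ?_)
    rw [← mul_add]
    refine mul_nonpos_of_nonneg_of_nonpos (hWpos τ).le ?_
    have h1 := bound τ
    simp only [mul_sub, Finset.sum_sub_distrib] at h1 ⊢
    linarith
  have cover (σ : Fin (m + 1) → V) : ∑ v, w v ≤ L σ + ∑ i, D (σ i) := by
    have h1 (i : Fin (m + 1)) :
        D (σ i) = ∑ v, ((if σ i = v then w v else 0) + if G.Adj (σ i) v then w v else 0) := by
      simp [hD, Finset.sum_add_distrib]
    have h0 (v : V) (i : Fin (m + 1)) :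
        0 ≤ (if σ i = v then w v else 0) + if G.Adj (σ i) v then w v else 0 := by
      have := hw v
      split_ifs <;> linarith
    simp only [h1, hL]
    rw [Finset.sum_comm, ← Finset.sum_add_distrib]
    refine Finset.sum_le_sum fun v _ => ?_
    split_ifs with hv
    · exact le_add_of_nonneg_right (Finset.sum_nonneg fun i _ => h0 v i)
    · push Not at hv
      obtain ⟨i, hi⟩ := hv
      rw [zero_add]
      refine le_trans ?_ (Finset.single_le_sum (fun i _ => h0 v i) (Finset.mem_univ i))
      rw [hH, not_and_or, not_not, not_not, G.adj_comm] at hi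
      have := hw v
      rcases hi with hi | hi
      · rw [if_pos hi.symm]; split_ifs <;> linarith
      · rw [if_pos hi]; split_ifs <;> linarith
  have pos (σ : Fin (m + 1) → V) : 0 < L σ + ∑ i, (D (σ i) - ∑ v, A (σ i) v * w v) := by
    have h1 : ∑ i : Fin (m + 1), ∑ v, A (σ i) v * w v < ∑ i : Fin (m + 1), (∑ v, w v) / (m + 1) :=
      Finset.sum_lt_sum_of_nonempty Finset.univ_nonempty fun i _ => by
        rw [lt_div_iff₀ (by positivity), mul_comm]; exact hsmall _
    have h2 : ∑ i : Fin (m + 1), (∑ v, w v) / (m + 1) = ∑ v, w v := by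
      simp; field_simp
    have h3 := cover σ
    rw [Finset.sum_sub_distrib]
    linarith
  have hterm (σ : Fin (m + 1) → V) :
      0 ≤ W σ * φ σ ^ 2 * (L σ + ∑ i, (D (σ i) - ∑ v, A (σ i) v * w v)) :=
    mul_nonneg (mul_nonneg (hWpos σ).le (sq_nonneg _)) (pos σ).le
  funext σ
  have hz := (Finset.sum_eq_zero_iff_of_nonneg fun σ _ => hterm σ).1
    (le_antisymm total (Finset.sum_nonneg fun σ _ => hterm σ)) σ (Finset.mem_univ σ)
  simpa using (mul_eq_zero.1 ((mul_eq_zero.1 hz).resolve_right (pos σ).ne')).resolve_left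
    (hWpos σ).ne'

/-- The cochains of the flag complex of `H` on `m`-tuples, as a subspace. -/
def flagCochains (H : SimpleGraph V) (m : ℕ) : Submodule ℝ ((Fin m → V) → ℝ) where
  carrier := {φ | H.IsFlagCochain φ}
  zero_mem' := ⟨fun _ _ => rfl, fun _ _ => by simp⟩
  add_mem' {φ ψ} hφ hψ := ⟨fun σ hσ => by simp [hφ.1 σ hσ, hψ.1 σ hσ],
    fun σ π => by simp [hφ.2 σ π, hψ.2 σ π, mul_add]⟩
  smul_mem' c φ hφ := ⟨fun σ hσ => by simp [hφ.1 σ hσ],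
    fun σ π => by simp [hφ.2 σ π, mul_left_comm]⟩

/-- The coboundary operator as a linear map. -/
noncomputable def coboundaryLM (H : SimpleGraph V) (m : ℕ) :
    ((Fin m → V) → ℝ) →ₗ[ℝ] ((Fin (m + 1) → V) → ℝ) where
  toFun := H.coboundary
  map_add' φ ψ := by
    funext σ
    by_cases hσ : H.IsFlagSimplex σ <;>
      simp [SimpleGraph.coboundary, hσ, mul_add, Finset.sum_add_distrib]
  map_smul' c φ := by
    funext σ
    by_cases hσ : H.IsFlagSimplex σ <;>
      simp [SimpleGraph.coboundary, hσ, Finset.mul_sum, mul_left_comm]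

/-- The weighted inner product on functions on `m`-tuples. -/
noncomputable def weightedForm (w : V → ℝ) (m : ℕ) :
    LinearMap.BilinForm ℝ ((Fin m → V) → ℝ) :=
  LinearMap.mk₂ ℝ (fun φ ψ => ∑ σ, (∏ j, w (σ j)) * φ σ * ψ σ)
    (fun φ φ' ψ => by simp [mul_add, add_mul, Finset.sum_add_distrib])
    (fun c φ ψ => by
      simp only [Pi.smul_apply, smul_eq_mul, Finset.mul_sum]
      exact Finset.sum_congr rfl fun σ _ => by ring)
    (fun φ ψ ψ' => by simp [mul_add, Finset.sum_add_distrib])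
    (fun c φ ψ => by
      simp only [Pi.smul_apply, smul_eq_mul, Finset.mul_sum]
      exact Finset.sum_congr rfl fun σ _ => by ring)

theorem weightedForm_apply (w : V → ℝ) (φ ψ : (Fin m → V) → ℝ) :
    weightedForm w m φ ψ = ∑ σ, (∏ j, w (σ j)) * φ σ * ψ σ := rfl

theorem weightedForm_self_eq_zero {w : V → ℝ} (hw : ∀ v, 0 < w v) {φ : (Fin m → V) → ℝ}
    (h : weightedForm w m φ φ = 0) : φ = 0 := by
  have hW (σ : Fin m → V) : 0 < ∏ j, w (σ j) := Finset.prod_pos fun j _ => hw _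
  have hn (σ : Fin m → V) : 0 ≤ (∏ j, w (σ j)) * φ σ * φ σ := by
    rw [mul_assoc]; exact mul_nonneg (hW σ).le (mul_self_nonneg _)
  funext σ
  have := (Finset.sum_eq_zero_iff_of_nonneg fun σ _ => hn σ).1 h σ (Finset.mem_univ σ)
  simpa [mul_assoc, (hW σ).ne'] using this

theorem weightedForm_isSymm (w : V → ℝ) : (weightedForm w m).IsSymm :=
  ⟨fun φ ψ => Finset.sum_congr rfl fun σ _ => by simp [mul_assoc, mul_comm (φ σ)]⟩

/-- A cochain orthogonal to all coboundaries is killed by the adjoint of the coboundary. -/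
theorem IsFlagCochain.codifferential_eq_zero {w : V → ℝ} (hw : ∀ v, 0 < w v)
    {φ : (Fin (m + 1) → V) → ℝ} (hφ : H.IsFlagCochain φ)
    (horth : ∀ ψ : (Fin m → V) → ℝ, H.IsFlagCochain ψ →
      weightedForm w (m + 1) φ (H.coboundary ψ) = 0) (τ : Fin m → V) :
    ∑ u, w u * φ (Fin.cons u τ) = 0 := by
  set ψ : (Fin m → V) → ℝ := fun τ => ∑ u, w u * φ (Fin.cons u τ) with hψ
  have hcochain : H.IsFlagCochain ψ := by
    refine ⟨fun τ hτ => Finset.sum_eq_zero fun u _ => ?_, fun τ π => ?_⟩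
    · rw [hφ.1 _ fun h => hτ (isFlagSimplex_cons.1 h).2, mul_zero]
    · have h1 (u : V) : (Fin.cons u (τ ∘ π) : Fin (m + 1) → V) =
          Fin.cons u τ ∘ Equiv.Perm.decomposeFin.symm (0, π) := by
        funext j
        cases j using Fin.cases <;> simp
      simp only [hψ, h1, hφ.2, Finset.mul_sum, Equiv.Perm.decomposeFin.symm_sign, if_true, one_mul]
      exact Finset.sum_congr rfl fun u _ => by ring
  have h1 := horth ψ hcochain
  have h2 : weightedForm w (m + 1) φ (H.coboundary ψ) = (m + 1) * weightedForm w m ψ ψ := by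
    have h3 := hφ.sum_mul_alternating w fun _ τ => ψ τ
    simp only [← Finset.sum_mul] at h3
    rw [weightedForm_apply, weightedForm_apply]
    simp only [mul_assoc] at h3 ⊢
    rw [← h3]
    refine Finset.sum_congr rfl fun σ _ => ?_
    by_cases hσ : H.IsFlagSimplex σ
    · rw [SimpleGraph.coboundary, if_pos hσ]
    · simp [hφ.1 σ hσ]
  rw [h2] at h1
  have h4 := (mul_eq_zero.1 h1).resolve_left (by positivity)
  exact congrFun (weightedForm_self_eq_zero hw h4) τ

/-- Cohomology vanishes as soon as every weighted harmonic cochain is zero. -/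
theorem flagCohomologyVanishes_of_harmonic {w : V → ℝ} (hw : ∀ v, 0 < w v)
    (h : ∀ φ : (Fin (m + 1) → V) → ℝ, H.IsFlagCochain φ → H.coboundary φ = 0 →
      (∀ τ : Fin m → V, ∑ u, w u * φ (Fin.cons u τ) = 0) → φ = 0) :
    H.flagCohomologyVanishes m := by
  intro φ hφ hd
  set B : Submodule ℝ ((Fin (m + 1) → V) → ℝ) := (H.flagCochains m).map (H.coboundaryLM m)
  have hcompl : IsCompl B ((weightedForm w (m + 1)).orthogonal B) := by
    refine LinearMap.BilinForm.isCompl_orthogonal_of_restrict_nondegenerate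
      (weightedForm_isSymm w).isRefl ?_
    refine ⟨fun b hb => ?_, fun b hb => ?_⟩ <;>
      exact Subtype.ext (weightedForm_self_eq_zero hw (hb b))
  obtain ⟨b, hb, c, hc, hbc⟩ := Submodule.mem_sup.1
    (hcompl.sup_eq_top ▸ Submodule.mem_top : φ ∈ B ⊔ (weightedForm w (m + 1)).orthogonal B)
  obtain ⟨ψ, hψ, rfl⟩ := hb
  refine ⟨ψ, hψ, ?_⟩
  have hc' : c = φ - H.coboundaryLM m ψ := by rw [← hbc]; abel
  suffices c = 0 by
    rw [this, add_zero] at hbc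
    exact hbc
  refine h c ?_ ?_ ?_
  · rw [hc']
    exact (H.flagCochains (m + 1)).sub_mem hφ (IsFlagCochain.coboundary hψ)
  · change H.coboundaryLM (m + 1) c = 0
    rw [hc', map_sub]
    change H.coboundary φ - H.coboundary (H.coboundary ψ) = 0
    rw [hd, coboundary_coboundary, sub_zero]
  · refine IsFlagCochain.codifferential_eq_zero (H := H) hw ?_ fun θ hθ => ?_
    · rw [hc']
      exact (H.flagCochains (m + 1)).sub_mem hφ (IsFlagCochain.coboundary hψ)
    · rw [(weightedForm_isSymm w).eq]
      exact hc _ ⟨θ, hθ, rfl⟩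

end SimpleGraph

/-- A linear programming alternative: either `A` has a fractional dominating vector of total
weight at most `s`, or there are positive weights on which `s • A` is strictly below average. -/
theorem exists_dominating_or_exists_weights {V : Type*} [Fintype V] (A : V → V → ℝ) {s : ℝ}
    (hs : 0 ≤ s) :
    (∃ α : V → ℝ, (∀ v, 0 ≤ α v) ∧ (∀ u, 1 ≤ ∑ v, α v * A v u) ∧ ∑ v, α v = s) ∨
      ∃ w : V → ℝ, (∀ v, 0 < w v) ∧ ∀ v, s * ∑ u, A v u * w u < ∑ u, w u := by
  classical
  by_cases hex : ∃ α : V → ℝ, (∀ v, 0 ≤ α v) ∧ (∀ u, 1 ≤ ∑ v, α v * A v u) ∧ ∑ v, α v = s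
  · exact Or.inl hex
  right
  let T : (V → ℝ) →ₗ[ℝ] (V → ℝ) :=
    { toFun := fun α u => s * ∑ v, α v * A v u
      map_add' := fun α β => by
        funext u; simp [add_mul, Finset.sum_add_distrib, mul_add]
      map_smul' := fun c α => by
        funext u; simp [Finset.mul_sum, mul_left_comm, mul_assoc] }
  have hdisj : Disjoint (T '' stdSimplex ℝ V) (Set.Ici (1 : V → ℝ)) := by
    rw [Set.disjoint_left]
    rintro _ ⟨α, hα, rfl⟩ h1
    refine hex ⟨fun v => s * α v, fun v => mul_nonneg hs (hα.1 v), fun u => ?_, ?_⟩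
    · have := h1 u
      simpa [T, Finset.mul_sum, mul_assoc] using this
    · rw [← Finset.mul_sum, hα.2, mul_one]
  obtain ⟨f, a, b, hfa, hab, hfb⟩ := geometric_hahn_banach_compact_closed
    ((convex_stdSimplex ℝ V).linear_image T)
    ((isCompact_stdSimplex ℝ V).image T.continuous_of_finiteDimensional)
    (convex_Ici (𝕜 := ℝ) (1 : V → ℝ)) isClosed_Ici hdisj
  set β : V → ℝ := fun u => f (Pi.single u 1) with hβ
  have hf (y : V → ℝ) : f y = ∑ u, y u * β u := by
    conv_lhs => rw [pi_eq_sum_univ' y]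
    simp [hβ]
  have hβ0 (u : V) : 0 ≤ β u := by
    by_contra! hneg
    have h1 (t : ℝ) (ht : 0 ≤ t) : b < f 1 + t * β u := by
      have := hfb (1 + t • Pi.single u 1) (by
        rw [Set.mem_Ici]
        refine le_add_of_nonneg_right (smul_nonneg ht ?_)
        exact Pi.single_nonneg.2 zero_le_one)
      simpa using this
    have h2 := hfb 1 (Set.mem_Ici.2 le_rfl)
    have h3 := h1 ((b - f 1) / β u) (div_nonneg_of_nonpos (by linarith) hneg.le)
    rw [div_mul_cancel₀ _ hneg.ne] at h3
    linarith
  have hlt (v : V) : s * ∑ u, A v u * β u < ∑ u, β u := by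
    have h1 := hfa _ ⟨Pi.single v 1, single_mem_stdSimplex ℝ v, rfl⟩
    have h2 := hfb 1 (Set.mem_Ici.2 le_rfl)
    rw [hf] at h1 h2
    simp only [T, LinearMap.coe_mk, AddHom.coe_mk, Pi.single_apply, ite_mul, one_mul, zero_mul,
      Finset.sum_ite_eq', Finset.mem_univ, if_true, Pi.one_apply] at h1 h2
    rw [Finset.mul_sum]
    simp only [← mul_assoc]
    linarith
  have hev : ∀ᶠ ε in nhdsWithin (0 : ℝ) (Set.Ioi 0), ∀ v,
      s * ∑ u, A v u * (β u + ε) < ∑ u, (β u + ε) := by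
    rw [Filter.eventually_all]
    intro v
    refine nhdsWithin_le_nhds ?_
    refine (Continuous.tendsto (f := fun ε : ℝ => s * ∑ u, A v u * (β u + ε)) (by fun_prop)
      0).eventually_lt (Continuous.tendsto (by fun_prop) 0) ?_
    simpa using hlt v
  obtain ⟨ε, hε, hpos⟩ := (hev.and self_mem_nhdsWithin).exists
  exact ⟨fun u => β u + ε, fun u => add_pos_of_nonneg_of_pos (hβ0 u) hpos, hε⟩

/-- If the `k`-th cohomology of the independence complex does not vanish, every vector
representation has value at most `k + 1`. -/
theorem SimpleGraph.IsVectorRep.repValue_le {V : Type*} [Fintype V] {G : SimpleGraph V}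
    {ι : Type*} [Fintype ι] {P : V → ι → ℝ} (hP : G.IsVectorRep P) {k : ℕ}
    (hk : ¬ (Gᶜ).flagCohomologyVanishes k) : repValue P ≤ k + 1 := by
  have hsymm (u v : V) : ∑ i, P u i * P v i = ∑ i, P v i * P u i :=
    Finset.sum_congr rfl fun i _ => mul_comm _ _
  have hpsd (x : V → ℝ) : 0 ≤ ∑ u, ∑ v, x u * x v * ∑ i, P u i * P v i := by
    have : ∑ u, ∑ v, x u * x v * ∑ i, P u i * P v i = ∑ i, (∑ u, x u * P u i) ^ 2 := by
      simp only [sq, Finset.sum_mul_sum]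
      rw [Finset.sum_comm (s := (Finset.univ : Finset ι))]
      refine Finset.sum_congr rfl fun u _ => ?_
      rw [Finset.sum_comm (s := (Finset.univ : Finset ι))]
      refine Finset.sum_congr rfl fun v _ => ?_
      rw [Finset.mul_sum]
      exact Finset.sum_congr rfl fun i _ => by ring
    rw [this]
    positivity
  rcases exists_dominating_or_exists_weights (fun u v => ∑ i, P u i * P v i)
    (s := k + 1) (by positivity) with ⟨α, h0, h1, h2⟩ | ⟨w, hw, hsmall⟩
  · refine sInf_le ⟨α, h0, h1, ?_⟩
    rw [h2, ENNReal.ofReal_add (by positivity) zero_le_one]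
    simp
  · refine absurd (SimpleGraph.flagCohomologyVanishes_of_harmonic hw fun φ hφ hd hδ => ?_) hk
    refine hφ.eq_zero_of_harmonic (G := G) (fun u v => G.compl_adj u v) hsymm (fun u v => ?_)
      hP.1 hpsd hw hsmall hd hδ
    by_cases huv : G.Adj u v
    · exact zero_le_one.trans (hP.1 u v huv)
    · exact hP.2 u v huv

/-- **Theorem 1.3** (Aharoni–Berger–Meshulam): for every finite simple graph `G`, the
homological connectivity of the independence complex is at least the vector domination
number: `η(I(G)) ≥ Γ(G)`. -/
theorem indepEta_ge_vecGamma {V : Type*} [Fintype V] [DecidableEq V] (G : SimpleGraph V) :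
    G.vecGamma ≤ (G.indepEta : ℝ≥0∞) := by
  refine sSup_le ?_
  rintro _ ⟨ℓ, P, hP, rfl⟩
  rw [SimpleGraph.indepEta]
  rcases Set.eq_empty_or_nonempty
    {i : ℕ∞ | ∃ k : ℕ, (k : ℕ∞) = i ∧ ¬ (Gᶜ).flagCohomologyVanishes k} with h | h
  · simp [h]
  · obtain ⟨k, hk, hvan⟩ := csInf_mem h
    rw [← hk]
    simpa using hP.repValue_le hvan
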